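/- arXiv:1401.0993 — 3 statements merged into one kernel-verified Lean document; each statement's English description precedes it below -/
import Mathlib

section
/- Let ξ be a real random variable, q > 2, n ≥ 1 an integer, and C₂, C₃, C₄ > 0 constants such that P(|ξ| > w) ≤ C₂ n / (n w)^q + C₃ e^{−C₄ n w²} for all w > 0. Then for every v > 0, E[ξ² 1(|ξ| > v)] ≤ C₅ n^{1−q} v^{2−q} + C₃ ((C₄ n)^{−1} + v²) e^{−C₄ n v²}, where C₅ = C₂ q/(q − 2). -/
open MeasureTheory

noncomputable section

/-- **Truncated second moment bound from a Nagaev-type tail inequality.**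
If `P(|ξ| > w) ≤ C₂ n/(nw)^q + C₃ e^{-C₄ n w²}` for all `w > 0`, then
`E[ξ² 1(|ξ| > v)] ≤ C₅ n^{1-q} v^{2-q} + C₃((C₄n)⁻¹ + v²) e^{-C₄ n v²}` with
`C₅ = C₂ q/(q-2)`. -/
theorem truncated_second_moment_bound {Ω : Type*} [MeasureSpace Ω]
    [IsProbabilityMeasure (volume : Measure Ω)]
    (ξ : Ω → ℝ) (hξ : Measurable ξ)
    (q : ℝ) (hq : 2 < q) (n : ℕ) (hn : 1 ≤ n)
    (C2 C3 C4 : ℝ) (hC2 : 0 < C2) (hC3 : 0 < C3) (hC4 : 0 < C4)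
    (htail : ∀ w : ℝ, 0 < w →
      (volume {ω | w < |ξ ω|}).toReal ≤
        C2 * n / ((n : ℝ) * w) ^ q + C3 * Real.exp (-(C4 * n * w ^ 2))) :
    ∀ v : ℝ, 0 < v →
      (∫ ω, if v < |ξ ω| then ξ ω ^ 2 else 0) ≤
        (C2 * q / (q - 2)) * (n : ℝ) ^ (1 - q) * v ^ (2 - q) +
          C3 * ((C4 * n)⁻¹ + v ^ 2) * Real.exp (-(C4 * n * v ^ 2)) := by
  intro v hv
  have hn0 : (0 : ℝ) < n := by exact_mod_cast hn
  have ha : 0 < C4 * n := by positivity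
  have hq2 : 0 < q - 2 := by linarith
  by_cases hInt : Integrable (fun ω => if v < |ξ ω| then ξ ω ^ 2 else 0) (volume : Measure Ω)
  swap
  · rw [integral_undef hInt]
    positivity
  set K : ℝ := C2 * (n : ℝ) ^ (1 - q) with hK
  have hK0 : 0 < K := by positivity
  set g : ℝ → ℝ := fun t => K * t ^ (-q / 2) + C3 * Real.exp (-(C4 * n) * t) with hg
  have hv2 : 0 < v ^ 2 := by positivity
  have htail' : ∀ s : ℝ, 0 < s → (volume {ω | √s < |ξ ω|}).toReal ≤ g s := by
    intro s hs
    have hs' := Real.sqrt_pos.2 hs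
    refine (htail _ hs').trans (le_of_eq ?_)
    have e1 : C2 * n / ((n : ℝ) * √s) ^ q = K * s ^ (-q / 2) := by
      rw [Real.mul_rpow hn0.le hs'.le, hK, Real.rpow_sub hn0, Real.rpow_one, Real.sqrt_eq_rpow,
        ← Real.rpow_mul hs.le, neg_div, Real.rpow_neg hs.le,
        show (1 / 2 * q : ℝ) = q / 2 by ring]
      have h1 := Real.rpow_pos_of_pos hn0 q
      have h2 := Real.rpow_pos_of_pos hs (q / 2)
      field_simp
    rw [e1, Real.sq_sqrt hs.le]
    simp only [hg, neg_mul]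
  have hpow := integrableOn_Ioi_rpow_of_lt (a := -q / 2) (by linarith) hv2
  have hexp := integrableOn_exp_mul_Ioi (a := -(C4 * n)) (by linarith) (v ^ 2)
  have hgi : IntegrableOn g (Set.Ioi (v ^ 2)) := (hpow.const_mul K).add (hexp.const_mul C3)
  have hgint : ∫ t in Set.Ioi (v ^ 2), g t =
      K * (-(v ^ 2) ^ (-q / 2 + 1) / (-q / 2 + 1)) +
        C3 * (-Real.exp (-(C4 * n) * v ^ 2) / (-(C4 * n))) := by
    rw [← integral_Ioi_rpow_of_lt (by linarith) hv2, ← integral_exp_mul_Ioi (by linarith),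
      ← integral_const_mul, ← integral_const_mul]
    exact integral_add (hpow.const_mul K) (hexp.const_mul C3)
  have c1 : Set.EqOn (fun t => g (max t (v ^ 2))) (fun _ => g (v ^ 2)) (Set.Ioc 0 (v ^ 2)) := by
    intro t ht
    simp only [max_eq_right ht.2]
  have c2 : Set.EqOn (fun t => g (max t (v ^ 2))) g (Set.Ioi (v ^ 2)) := by
    intro t ht
    simp only [max_eq_left (le_of_lt (Set.mem_Ioi.1 ht))]
  have i1 : IntegrableOn (fun t => g (max t (v ^ 2))) (Set.Ioc 0 (v ^ 2)) :=
    (integrableOn_congr_fun c1 measurableSet_Ioc).2 (by simp)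
  have i2 : IntegrableOn (fun t => g (max t (v ^ 2))) (Set.Ioi (v ^ 2)) :=
    (integrableOn_congr_fun c2 measurableSet_Ioi).2 hgi
  have hU : Set.Ioc 0 (v ^ 2) ∪ Set.Ioi (v ^ 2) = Set.Ioi 0 := Set.Ioc_union_Ioi_eq_Ioi hv2.le
  have hi : IntegrableOn (fun t => g (max t (v ^ 2))) (Set.Ioi 0) := by
    rw [← hU]; exact i1.union i2
  have hval : ∫ t in Set.Ioi 0, g (max t (v ^ 2)) =
      v ^ 2 * g (v ^ 2) + ∫ t in Set.Ioi (v ^ 2), g t := by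
    rw [← hU, setIntegral_union (Set.Ioc_disjoint_Ioi le_rfl) measurableSet_Ioi i1 i2,
      setIntegral_congr_fun measurableSet_Ioc c1, setIntegral_congr_fun measurableSet_Ioi c2]
    simp [hv2.le]
  rw [hInt.integral_eq_integral_meas_lt (Filter.Eventually.of_forall fun ω => by
    dsimp only [Pi.zero_apply]; split_ifs <;> positivity)]
  have hle : ∫ t in Set.Ioi (0 : ℝ),
      (volume : Measure Ω).real {ω | t < if v < |ξ ω| then ξ ω ^ 2 else 0} ≤
      ∫ t in Set.Ioi 0, g (max t (v ^ 2)) := by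
    refine integral_mono_of_nonneg (Filter.Eventually.of_forall fun t => measureReal_nonneg) hi ?_
    refine (ae_restrict_iff' measurableSet_Ioi).2 (Filter.Eventually.of_forall fun t ht => ?_)
    have ht : 0 < t := ht
    refine le_trans ?_ (htail' (max t (v ^ 2)) (lt_max_of_lt_left ht))
    refine measureReal_mono ?_
    intro ω hω
    simp only [Set.mem_ofPred_eq] at hω ⊢
    split_ifs at hω with h
    · rw [Real.sqrt_lt' (hv.trans h), sq_abs]
      refine max_lt hω ?_
      rw [← sq_abs (ξ ω)]
      gcongr
    · linarith
  refine hle.trans (le_of_eq ?_)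
  rw [hval, hgint]
  have p1 : (v ^ 2) ^ (-q / 2 + 1) = v ^ (2 - q) := by
    rw [← Real.rpow_natCast v 2, ← Real.rpow_mul hv.le]
    congr 1; push_cast; ring
  have p2 : v ^ 2 * (v ^ 2) ^ (-q / 2) = v ^ (2 - q) := by
    rw [← p1, Real.rpow_add_one hv2.ne']; ring
  have p3 : -q / 2 + 1 = -((q - 2) / 2) := by ring
  have p4 : C2 * q / (q - 2) * (n : ℝ) ^ (1 - q) = K * (q / (q - 2)) := by rw [hK]; ring
  rw [p1, p4, p3]
  simp only [hg]
  rw [mul_add, mul_left_comm, p2, neg_mul]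
  field_simp
  ring
end
end

section
/- Let Σ be a p × p real positive semidefinite matrix, let T be a real symmetric p × p matrix with eigendecomposition T = Σ_{j=1}^p λ̂_j q_j q_jᵀ (q_1, …, q_p orthonormal), and suppose |T − Σ|_F² ≤ p² ϖ² for some ϖ > 0. For 0 < v ≤ √p · ϖ define S̃_v = Σ_{j=1}^p max(λ̂_j, v) q_j q_jᵀ. Then every eigenvalue of S̃_v is at least v (so S̃_v is positive definite) and |S̃_v − Σ|_F² ≤ 10 ϖ² p². -/
open scoped BigOperators Matrix

noncomputable section

/-- Squared Frobenius norm. -/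
def frobSq {p : ℕ} (M : Matrix (Fin p) (Fin p) ℝ) : ℝ := ∑ j, ∑ k, M j k ^ 2

lemma frobSq_trace {p : ℕ} (M : Matrix (Fin p) (Fin p) ℝ) : frobSq M = (M * Mᵀ).trace := by
  simp [frobSq, Matrix.trace, Matrix.mul_apply, sq]

lemma frobSq_conj {p : ℕ} (M Q : Matrix (Fin p) (Fin p) ℝ) (hQ : Qᵀ * Q = 1) :
    frobSq (Q * M * Qᵀ) = frobSq M := by
  rw [frobSq_trace, frobSq_trace]
  have : Q * M * Qᵀ * (Q * M * Qᵀ)ᵀ = Q * (M * Mᵀ * Qᵀ) := by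
    simp only [Matrix.transpose_mul, Matrix.transpose_transpose]
    calc _ = Q * M * (Qᵀ * Q) * Mᵀ * Qᵀ := by simp only [Matrix.mul_assoc]
      _ = _ := by rw [hQ]; simp only [Matrix.mul_assoc, Matrix.mul_one]
  rw [this, Matrix.trace_mul_comm, Matrix.mul_assoc, hQ, Matrix.mul_one]

lemma frobSq_add {p : ℕ} (M N : Matrix (Fin p) (Fin p) ℝ) :
    frobSq (M + N) ≤ 2 * frobSq M + 2 * frobSq N := by
  simp only [frobSq, Finset.mul_sum, ← Finset.sum_add_distrib]
  refine Finset.sum_le_sum fun j _ => Finset.sum_le_sum fun k _ => ?_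
  rw [Matrix.add_apply]
  nlinarith [sq_nonneg (M j k - N j k)]

lemma frobSq_diag {p : ℕ} (d : Fin p → ℝ) : frobSq (Matrix.diagonal d) = ∑ j, d j ^ 2 := by
  unfold frobSq
  refine Finset.sum_congr rfl fun j _ => ?_
  rw [Finset.sum_eq_single j]
  · simp
  · intro k _ hk
    simp [Matrix.diagonal_apply_ne _ hk.symm]
  · simp

lemma diag_le_frobSq {p : ℕ} (M : Matrix (Fin p) (Fin p) ℝ) : ∑ j, M j j ^ 2 ≤ frobSq M := by
  refine Finset.sum_le_sum fun j _ => ?_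
  exact Finset.single_le_sum (f := fun k => M j k ^ 2) (fun k _ => sq_nonneg _) (Finset.mem_univ j)

lemma sum_eq_conj {p : ℕ} (d : Fin p → ℝ) (q : Fin p → Fin p → ℝ) :
    ∑ j : Fin p, d j • Matrix.vecMulVec (q j) (q j)
      = (Matrix.of q)ᵀ * Matrix.diagonal d * Matrix.of q := by
  ext a b
  simp only [Matrix.sum_apply, Matrix.smul_apply, Matrix.vecMulVec_apply,
    Matrix.mul_apply (M := _ * _), Matrix.mul_diagonal, Matrix.transpose_apply, Matrix.of_apply, smul_eq_mul]
  exact Finset.sum_congr rfl fun j _ => by ring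

/-- **Positive-definitization of the thresholded estimator.** If `T = Σ_j λ̂_j q_j q_jᵀ`
with orthonormal `q_j`, `Σ` is positive semidefinite and `|T - Σ|_F² ≤ p²ϖ²`, then for
`0 < v ≤ √p·ϖ` the matrix `S̃_v = Σ_j (λ̂_j ∨ v) q_j q_jᵀ` has all eigenvalues at least `v`
(hence is positive definite) and satisfies `|S̃_v - Σ|_F² ≤ 10 ϖ² p²`. -/
theorem positive_definitization (p : ℕ) (hp : 0 < p)
    (Sigma T : Matrix (Fin p) (Fin p) ℝ)
    (hSigma : Sigma.PosSemidef)
    (lamhat : Fin p → ℝ) (q : Fin p → Fin p → ℝ)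
    (horth : ∀ i j : Fin p, q i ⬝ᵥ q j = if i = j then (1 : ℝ) else 0)
    (hT : T = ∑ j : Fin p, lamhat j • Matrix.vecMulVec (q j) (q j))
    (ϖ v : ℝ) (hϖ : 0 < ϖ)
    (hfrob : ∑ j : Fin p, ∑ k : Fin p, (T - Sigma) j k ^ 2 ≤ (p : ℝ) ^ 2 * ϖ ^ 2)
    (hv0 : 0 < v) (hv : v ≤ Real.sqrt p * ϖ) :
    (∀ c : ℝ,
        Module.End.HasEigenvalue
          (Matrix.toLin' (∑ j : Fin p, max (lamhat j) v • Matrix.vecMulVec (q j) (q j)))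
          c → v ≤ c) ∧
      (∑ j : Fin p, max (lamhat j) v • Matrix.vecMulVec (q j) (q j)).PosDef ∧
      ∑ j : Fin p, ∑ k : Fin p,
          ((∑ l : Fin p, max (lamhat l) v • Matrix.vecMulVec (q l) (q l)) - Sigma) j k ^ 2 ≤
        10 * ϖ ^ 2 * (p : ℝ) ^ 2 := by
  have hQ' : Matrix.of q * (Matrix.of q)ᵀ = 1 := by
    ext i j
    rw [Matrix.one_apply, ← horth i j]
    simp [Matrix.mul_apply, dotProduct]
  have hQ : (Matrix.of q)ᵀ * Matrix.of q = 1 := mul_eq_one_comm.mp hQ'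
  have hfr : frobSq (T - Sigma) ≤ (p : ℝ) ^ 2 * ϖ ^ 2 := hfrob
  simp only [sum_eq_conj] at hT ⊢
  change _ ∧ _ ∧ frobSq _ ≤ _
  set Q := Matrix.of q with hQdef
  set S := Qᵀ * Matrix.diagonal (fun j => max (lamhat j) v) * Q with hS
  have hQSQ : ∀ M : Matrix (Fin p) (Fin p) ℝ, Q * (Qᵀ * M * Q) * Qᵀ = M := by
    intro M
    calc _ = (Q * Qᵀ) * M * (Q * Qᵀ) := by simp only [Matrix.mul_assoc]
      _ = M := by rw [hQ', Matrix.one_mul, Matrix.mul_one]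
  have hpsd : (S - v • (1 : Matrix (Fin p) (Fin p) ℝ)).PosSemidef := by
    have h1 : S - v • (1 : Matrix (Fin p) (Fin p) ℝ)
        = Qᴴ * Matrix.diagonal (fun j => max (lamhat j) v - v) * Q := by
      have : Matrix.diagonal (fun j => max (lamhat j) v - v)
          = Matrix.diagonal (fun j => max (lamhat j) v) - v • (1 : Matrix (Fin p) (Fin p) ℝ) := by
        rw [Matrix.smul_one_eq_diagonal, Matrix.diagonal_sub]
      rw [this, Matrix.conjTranspose_eq_transpose_of_trivial, Matrix.mul_sub, Matrix.sub_mul,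
        Matrix.mul_smul, Matrix.smul_mul, Matrix.mul_one, hQ]
    rw [h1]
    apply Matrix.PosSemidef.conjTranspose_mul_mul_same
    apply Matrix.PosSemidef.diagonal
    intro j
    simp
  refine ⟨?_, ?_, ?_⟩
  · intro c hc
    obtain ⟨x, hx⟩ := hc.exists_hasEigenvector
    have hx1 : S *ᵥ x = c • x := by simpa using hx.apply_eq_smul
    have hx0 : x ≠ 0 := hx.2
    have h2 := hpsd.dotProduct_mulVec_nonneg x
    rw [Matrix.sub_mulVec, hx1, Matrix.smul_mulVec, Matrix.one_mulVec, ← sub_smul,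
      dotProduct_smul, smul_eq_mul, star_trivial] at h2
    have h3 : 0 < x ⬝ᵥ x := by
      have := Matrix.dotProduct_star_self_pos_iff.mpr hx0
      simpa using this
    nlinarith [nonneg_of_mul_nonneg_left h2 h3]
  · have h1 : S = (S - v • (1 : Matrix (Fin p) (Fin p) ℝ)) + v • 1 := by simp
    rw [h1]
    exact Matrix.PosDef.posSemidef_add hpsd (Matrix.PosDef.one.smul hv0)
  · have hB : frobSq (Q * (T - Sigma) * Qᵀ) = frobSq (T - Sigma) := frobSq_conj _ _ hQ
    have hBle : ∀ j, (Q * (T - Sigma) * Qᵀ) j j ≤ lamhat j := by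
      intro j
      have h1 : (Q * Sigma * Qᵀ).PosSemidef := by
        have := hSigma.mul_mul_conjTranspose_same Q
        rwa [Matrix.conjTranspose_eq_transpose_of_trivial] at this
      have h2 := h1.diag_nonneg (i := j)
      rw [Matrix.mul_sub, Matrix.sub_mul, hT, hQSQ, Matrix.sub_apply, Matrix.diagonal_apply_eq]
      linarith
    have hST : frobSq (S - T) = ∑ j, (max (lamhat j) v - lamhat j) ^ 2 := by
      rw [← frobSq_conj _ _ hQ, Matrix.mul_sub, Matrix.sub_mul, hT, hS, hQSQ, hQSQ,
        Matrix.diagonal_sub, frobSq_diag]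
    have hv2 : v ^ 2 ≤ p * ϖ ^ 2 := by
      calc v ^ 2 ≤ (Real.sqrt p * ϖ) ^ 2 := pow_le_pow_left₀ hv0.le hv 2
        _ = p * ϖ ^ 2 := by rw [mul_pow, Real.sq_sqrt (Nat.cast_nonneg p)]
    have h4 : frobSq (S - T) ≤ 2 * (p * v ^ 2) + 2 * frobSq (T - Sigma) := by
      calc frobSq (S - T) = ∑ j, (max (lamhat j) v - lamhat j) ^ 2 := hST
        _ ≤ ∑ j, (2 * v ^ 2 + 2 * (Q * (T - Sigma) * Qᵀ) j j ^ 2) := by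
          refine Finset.sum_le_sum fun j _ => ?_
          have hb := hBle j
          generalize (Q * (T - Sigma) * Qᵀ) j j = b at hb
          rcases le_total v (lamhat j) with h | h
          · rw [max_eq_left h, sub_self]
            nlinarith [sq_nonneg v, sq_nonneg b]
          · rw [max_eq_right h]
            rcases le_total 0 (lamhat j) with h0 | h0
            · nlinarith [sq_nonneg b]
            · nlinarith [sq_nonneg (v + lamhat j)]
        _ = 2 * (p * v ^ 2) + 2 * ∑ j, (Q * (T - Sigma) * Qᵀ) j j ^ 2 := by
          rw [Finset.sum_add_distrib, ← Finset.mul_sum (f := fun j => (Q * (T - Sigma) * Qᵀ) j j ^ 2),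
            Finset.sum_const, Finset.card_univ, Fintype.card_fin, nsmul_eq_mul]
          ring
        _ ≤ _ := by
          have := diag_le_frobSq (Q * (T - Sigma) * Qᵀ)
          rw [hB] at this
          linarith
    have h5 : frobSq (S - Sigma) ≤ 2 * frobSq (S - T) + 2 * frobSq (T - Sigma) := by
      have := frobSq_add (S - T) (T - Sigma)
      rwa [sub_add_sub_cancel] at this
    have h6 : (p : ℝ) * v ^ 2 ≤ p * (p * ϖ ^ 2) :=
      mul_le_mul_of_nonneg_left hv2 (Nat.cast_nonneg p)
    nlinarith
end
end

section
/- Let σ_{jk}, 1 ≤ j, k ≤ p, be real numbers with |σ_{jk}| ≤ 1, let K, χ > 0 with K < χ/2, and let C > 0 be such that p^{−2} Σ_{j,k=1}^p 1(|σ_{jk}| ≥ u) ≤ p^{−1} min(p, C u^{−χ/K}) for all u > 0. Then there is a constant C' depending only on C, K, χ such that p^{−2} Σ_{j,k=1}^p σ_{jk}² ≤ C' p^{−2K/χ}, and consequently D(u) = p^{−2} Σ_{j,k=1}^p min(u², σ_{jk}²) ≤ min(C' p^{−2K/χ}, u²) for all u > 0. -/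
open scoped BigOperators

noncomputable section

theorem dyadic_pointwise (v s : ℝ) (hv : 0 < v) (hs : 0 ≤ s) (n : ℕ) (h : s < 2 ^ n * v) :
    s ^ 2 ≤ v ^ 2 + ∑ i ∈ Finset.range n,
      (2 ^ (i + 1) * v) ^ 2 * (if 2 ^ i * v ≤ s then (1 : ℝ) else 0) := by
  induction n with
  | zero =>
    simp at h ⊢
    exact pow_le_pow_left₀ hs h.le 2
  | succ n ih =>
    rw [Finset.sum_range_succ]
    by_cases h2 : s < 2 ^ n * v
    · have := ih h2
      have h3 : 0 ≤ (2 ^ (n + 1) * v) ^ 2 * (if 2 ^ n * v ≤ s then (1 : ℝ) else 0) := by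
        positivity
      linarith
    · rw [if_pos (not_lt.mp h2)]
      have h3 : 0 ≤ ∑ i ∈ Finset.range n,
          (2 ^ (i + 1) * v) ^ 2 * (if 2 ^ i * v ≤ s then (1 : ℝ) else 0) :=
        Finset.sum_nonneg fun i _ => by positivity
      have h4 : s ^ 2 ≤ (2 ^ (n + 1) * v) ^ 2 := pow_le_pow_left₀ hs h.le 2
      nlinarith [sq_nonneg v]

/-- **Smallness measure under strong spatial dependence (`K < χ/2`).** If `|σ_{jk}| ≤ 1` and
`p⁻² Σ_{j,k} 1(|σ_{jk}| ≥ u) ≤ p⁻¹ min(p, C u^{-χ/K})` for all `u > 0`, then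
`p⁻² Σ_{j,k} σ_{jk}² ≤ C' p^{-2K/χ}` and hence
`D(u) = p⁻² Σ_{j,k} min(u², σ_{jk}²) ≤ min(C' p^{-2K/χ}, u²)`, where `C'` depends only on
`C, K, χ`. -/
theorem smallness_measure_strong_spatial_dependence
    (K χ C : ℝ) (hK : 0 < K) (hχ : 0 < χ) (hKχ : K < χ / 2) (hC : 0 < C) :
    ∃ C' : ℝ, 0 < C' ∧
      ∀ (p : ℕ) (σ : Fin p → Fin p → ℝ), 0 < p →
        (∀ j k, |σ j k| ≤ 1) →
        (∀ u : ℝ, 0 < u →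
          ((p : ℝ) ^ 2)⁻¹ * ∑ j : Fin p, ∑ k : Fin p, (if u ≤ |σ j k| then (1 : ℝ) else 0) ≤
            (p : ℝ)⁻¹ * min (p : ℝ) (C * u ^ (-(χ / K)))) →
        (((p : ℝ) ^ 2)⁻¹ * ∑ j : Fin p, ∑ k : Fin p, σ j k ^ 2 ≤
            C' * (p : ℝ) ^ (-(2 * K / χ))) ∧
          ∀ u : ℝ, 0 < u →
            ((p : ℝ) ^ 2)⁻¹ * ∑ j : Fin p, ∑ k : Fin p, min (u ^ 2) (σ j k ^ 2) ≤
              min (C' * (p : ℝ) ^ (-(2 * K / χ))) (u ^ 2) := by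
  have ha : 2 < χ / K := by
    rw [lt_div_iff₀ hK]; linarith
  obtain ⟨r, hr⟩ : ∃ r : ℝ, r = 4 * (2 : ℝ) ^ (-(χ / K)) := ⟨_, rfl⟩
  have hr0 : 0 < r := by rw [hr]; positivity
  have hr1 : r < 1 := by
    have h1 : (2 : ℝ) ^ (-(χ / K)) < (2 : ℝ) ^ (-2 : ℝ) :=
      Real.rpow_lt_rpow_of_exponent_lt (by norm_num) (by linarith)
    have h2 : (2 : ℝ) ^ (-2 : ℝ) = 1 / 4 := by
      rw [Real.rpow_neg (by norm_num)]; norm_num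
    rw [hr]; linarith
  have hr2 : 0 < 1 - r := by linarith
  refine ⟨1 + 4 * C * (1 - r)⁻¹, by positivity, ?_⟩
  intro p σ hp hσ htail
  have hp' : (0 : ℝ) < p := by exact_mod_cast hp
  have key : ((p : ℝ) ^ 2)⁻¹ * ∑ j : Fin p, ∑ k : Fin p, σ j k ^ 2 ≤
      (1 + 4 * C * (1 - r)⁻¹) * (p : ℝ) ^ (-(2 * K / χ)) := by
    obtain ⟨v, hvdef⟩ : ∃ v : ℝ, v = (p : ℝ) ^ (-(K / χ)) := ⟨_, rfl⟩
    have hv : 0 < v := by rw [hvdef]; positivity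
    have hv2 : v ^ 2 = (p : ℝ) ^ (-(2 * K / χ)) := by
      rw [hvdef, ← Real.rpow_natCast, ← Real.rpow_mul hp'.le]
      congr 1; push_cast; ring
    have hva : v ^ (-(χ / K)) = p := by
      rw [hvdef, ← Real.rpow_mul hp'.le]
      have : -(K / χ) * -(χ / K) = 1 := by field_simp
      rw [this, Real.rpow_one]
    obtain ⟨n, hn⟩ := pow_unbounded_of_one_lt v⁻¹ (one_lt_two : (1 : ℝ) < 2)
    have hn' : 1 < 2 ^ n * v := by
      have := mul_lt_mul_of_pos_right hn hv
      rwa [inv_mul_cancel₀ hv.ne'] at this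
    have hpt : ∀ j k, σ j k ^ 2 ≤ v ^ 2 + ∑ i ∈ Finset.range n,
        (2 ^ (i + 1) * v) ^ 2 * (if 2 ^ i * v ≤ |σ j k| then (1 : ℝ) else 0) := by
      intro j k
      rw [← sq_abs]
      exact dyadic_pointwise v _ hv (abs_nonneg _) n ((hσ j k).trans_lt hn')
    have hsum : ∑ j : Fin p, ∑ k : Fin p, σ j k ^ 2 ≤ (p : ℝ) ^ 2 * v ^ 2 +
        ∑ i ∈ Finset.range n, (2 ^ (i + 1) * v) ^ 2 *
          ∑ j : Fin p, ∑ k : Fin p, (if 2 ^ i * v ≤ |σ j k| then (1 : ℝ) else 0) := by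
      refine (Finset.sum_le_sum fun j _ => Finset.sum_le_sum fun k _ => hpt j k).trans_eq ?_
      simp only [Finset.sum_add_distrib, Finset.mul_sum]
      congr 1
      · simp; ring
      · symm
        rw [Finset.sum_comm]
        refine Finset.sum_congr rfl fun j _ => ?_
        rw [Finset.sum_comm]
    have hterm : ∀ i, ((p : ℝ) ^ 2)⁻¹ * ((2 ^ (i + 1) * v) ^ 2 *
          ∑ j : Fin p, ∑ k : Fin p, (if 2 ^ i * v ≤ |σ j k| then (1 : ℝ) else 0)) ≤
          4 * C * v ^ 2 * r ^ i := by
      intro i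
      have h1 := (htail (2 ^ i * v) (by positivity)).trans
        (mul_le_mul_of_nonneg_left (min_le_right _ _) (by positivity))
      have h2 : ((2 : ℝ) ^ i * v) ^ (-(χ / K)) = ((2 : ℝ) ^ (-(χ / K))) ^ i * p := by
        rw [Real.mul_rpow (by positivity) hv.le, hva, ← Real.rpow_natCast, ← Real.rpow_natCast,
          ← Real.rpow_mul (by norm_num), ← Real.rpow_mul (by norm_num), mul_comm (i : ℝ)]
      rw [h2] at h1
      have h3 := mul_le_mul_of_nonneg_left h1 (sq_nonneg (2 ^ (i + 1) * v))
      calc _ = (2 ^ (i + 1) * v) ^ 2 * (((p : ℝ) ^ 2)⁻¹ *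
          ∑ j : Fin p, ∑ k : Fin p, (if 2 ^ i * v ≤ |σ j k| then (1 : ℝ) else 0)) := by ring
        _ ≤ _ := h3
        _ = _ := by
          rw [hr, mul_pow 4]
          have h4 : (4 : ℝ) ^ i = (2 ^ i) ^ 2 := by
            rw [← pow_mul, mul_comm, pow_mul]; norm_num
          rw [h4]
          field_simp
          ring
    have hgeom : ∑ i ∈ Finset.range n, r ^ i ≤ (1 - r)⁻¹ := by
      rw [← tsum_geometric_of_lt_one hr0.le hr1]
      exact (summable_geometric_of_lt_one hr0.le hr1).sum_le_tsum _ fun i _ => by positivity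
    rw [← hv2]
    calc _ ≤ ((p : ℝ) ^ 2)⁻¹ * _ := mul_le_mul_of_nonneg_left hsum (by positivity)
      _ = v ^ 2 + ∑ i ∈ Finset.range n, ((p : ℝ) ^ 2)⁻¹ * ((2 ^ (i + 1) * v) ^ 2 *
          ∑ j : Fin p, ∑ k : Fin p, (if 2 ^ i * v ≤ |σ j k| then (1 : ℝ) else 0)) := by
        rw [mul_add, Finset.mul_sum, ← mul_assoc, inv_mul_cancel₀ (by positivity), one_mul]
      _ ≤ v ^ 2 + ∑ i ∈ Finset.range n, 4 * C * v ^ 2 * r ^ i := by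
        exact add_le_add_right (Finset.sum_le_sum fun i _ => hterm i) _
      _ ≤ v ^ 2 + 4 * C * v ^ 2 * (1 - r)⁻¹ := by
        rw [← Finset.mul_sum]; gcongr
      _ = _ := by ring
  refine ⟨key, fun u hu => le_min (le_trans ?_ key) ?_⟩
  · gcongr
    exact min_le_right _ _
  · calc _ ≤ ((p : ℝ) ^ 2)⁻¹ * ∑ j : Fin p, ∑ k : Fin p, u ^ 2 := by
          gcongr
          exact min_le_left _ _
      _ = u ^ 2 := by
          simp; field_simp
end
end
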